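/- arXiv:0810.4236 — 3 statements merged into one kernel-verified Lean document; each statement's English description precedes it below -/
import Mathlib

section
/- (Lemma 2.1(2)) For all indices i, j with 2 ≤ i, j ≤ k and i + j = k + 2, one has u_i = u_j. -/
open Finset

/-- The set `F = { l / w j : 0 ≤ l ≤ w j - 1, 0 ≤ j ≤ n }` of rational numbers. -/
def wpF (n : ℕ) (w : Fin (n + 1) → ℕ) : Finset ℚ :=
  (Finset.univ.sigma fun j : Fin (n + 1) => Finset.range (w j)).image
    fun p => (p.2 : ℚ) / (w p.1 : ℚ)

-- The set `S f = { j ∈ {0,…,n} : w j · f ∈ ℤ }`.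
open Classical in
noncomputable def wpS (n : ℕ) (w : Fin (n + 1) → ℕ) (x : ℚ) : Finset (Fin (n + 1)) :=
  Finset.univ.filter fun j => ∃ z : ℤ, (w j : ℚ) * x = (z : ℚ)

/-- The nonzero part of `wpF n w` is stable under `x ↦ 1 - x`. -/
theorem one_sub_mem_wpF {n : ℕ} {w : Fin (n + 1) → ℕ} (hw : ∀ j, 0 < w j) {x : ℚ}
    (hx : x ∈ wpF n w) (hx0 : x ≠ 0) : 1 - x ∈ wpF n w := by
  simp only [wpF, mem_image, mem_sigma, mem_univ, true_and, mem_range, Sigma.exists] at hx ⊢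
  obtain ⟨j, l, hl, rfl⟩ := hx
  have hl0 : l ≠ 0 := by
    rintro rfl
    simp at hx0
  have hwj : (w j : ℚ) ≠ 0 := by exact_mod_cast (hw j).ne'
  refine ⟨j, w j - l, by omega, ?_⟩
  rw [Nat.cast_sub hl.le]
  field_simp

theorem wpS_one_sub (n : ℕ) (w : Fin (n + 1) → ℕ) (x : ℚ) : wpS n w (1 - x) = wpS n w x := by
  ext j
  simp only [wpS, mem_filter, mem_univ, true_and]
  constructor
  · rintro ⟨z, hz⟩
    refine ⟨w j - z, ?_⟩
    push_cast
    linarith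
  · rintro ⟨z, hz⟩
    refine ⟨w j - z, ?_⟩
    push_cast
    linarith

/-- A strictly decreasing self-map of `{1, …, m}` is the reversal `i ↦ m + 1 - i`. -/
theorem add_eq_of_strictly_decreasing {m : ℕ} {a : ℕ → ℕ}
    (hpos : ∀ i, 1 ≤ i → i ≤ m → 1 ≤ a i) (hle : ∀ i, 1 ≤ i → i ≤ m → a i ≤ m)
    (hanti : ∀ i, 1 ≤ i → i + 1 ≤ m → a (i + 1) < a i) {i : ℕ} (hi : 1 ≤ i) (him : i ≤ m) :
    a i + i = m + 1 := by
  have upper : a i + i ≤ m + 1 := by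
    induction i, hi using Nat.le_induction with
    | base => have := hle 1 le_rfl him; omega
    | succ i hi ih =>
      have := ih (by omega)
      have := hanti i hi him
      omega
  have lower : m + 1 ≤ a i + i := by
    clear upper
    induction him using Nat.decreasingInduction with
    | self => have := hpos m hi le_rfl; omega
    | of_succ i him ih =>
      have := ih (by omega)
      have := hanti i hi him
      omega
  omega

theorem lemma_2_1_2 (n k : ℕ) (w : Fin (n + 1) → ℕ) (hw : ∀ j, 0 < w j)
    (f : ℕ → ℚ)
    (hmono : ∀ i j : ℕ, 1 ≤ i → i < j → j ≤ k + 1 → f i < f j)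
    (hmem : ∀ i : ℕ, 1 ≤ i → i ≤ k → f i ∈ wpF n w)
    (hsurj : ∀ x ∈ wpF n w, ∃ i : ℕ, 1 ≤ i ∧ i ≤ k ∧ f i = x)
    (hf1 : f 1 = 0) (hfk1 : f (k + 1) = 1) :
    ∀ i j : ℕ, 2 ≤ i → i ≤ k → 2 ≤ j → j ≤ k → i + j = k + 2 →
      (wpS n w (f i)).card = (wpS n w (f j)).card := by
  have hrefl : ∀ i, ∃ a, 1 ≤ i → i ≤ k + 1 → 1 ≤ a ∧ a ≤ k + 1 ∧ f a = 1 - f i := by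
    intro i
    by_cases hi : 1 ≤ i ∧ i ≤ k + 1
    · obtain ⟨hi1, hik⟩ := hi
      rcases hi1.eq_or_lt with rfl | hi2
      · exact ⟨k + 1, fun _ _ => ⟨by omega, le_rfl, by rw [hf1, hfk1, sub_zero]⟩⟩
      rcases hik.eq_or_lt with rfl | hik'
      · exact ⟨1, fun _ _ => ⟨le_rfl, by omega, by rw [hf1, hfk1, sub_self]⟩⟩
      have hi0 : f i ≠ 0 := by
        have := hmono 1 i le_rfl hi2 hik
        rw [hf1] at this
        exact this.ne'
      obtain ⟨a, ha1, hak, ha⟩ :=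
        hsurj _ (one_sub_mem_wpF hw (hmem i hi1 (by omega)) hi0)
      exact ⟨a, fun _ _ => ⟨ha1, by omega, ha⟩⟩
    · exact ⟨0, fun h1 h2 => absurd ⟨h1, h2⟩ hi⟩
  choose a ha using hrefl
  intro i j hi hik _ _ hij
  have hai : a i + i = k + 1 + 1 := by
    refine add_eq_of_strictly_decreasing (fun i h1 h2 => (ha i h1 h2).1)
      (fun i h1 h2 => (ha i h1 h2).2.1) (fun i h1 h2 => ?_) (by omega) (by omega)
    obtain ⟨hpos, -, hfi⟩ := ha i h1 (by omega)
    obtain ⟨-, hle, hfs⟩ := ha (i + 1) (by omega) h2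
    have hlt := hmono i (i + 1) h1 (by omega) h2
    by_contra! hcon
    rcases hcon.eq_or_lt with heq | hlt'
    · rw [heq] at hfi
      linarith
    · linarith [hmono _ _ hpos hlt' hle]
  obtain rfl : j = a i := by omega
  rw [(ha i (by omega) (by omega)).2.2, wpS_one_sub]
end

section
/- (Age formula) For every i with 1 ≤ i ≤ k, one has Σ_{j=0}^n ⟨−w_j·f_i⟩ = (u_1 + u_2 + ⋯ + u_{i−1}) − σ·f_i, where ⟨r⟩ = r − ⌊r⌋ denotes the fractional part of a rational number r (for i = 1 the empty sum u_1+⋯+u_0 is 0). In particular the age of the twisted sector class 1_{f_i} of ℙ(w_0,…,w_n) equals (u_1+⋯+u_{i−1}) − σ f_i. -/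
open Finset

/-- The indices `l < i` for which `a * f l` is an integer are in bijection with the natural numbers
below `a * f i`. -/
theorem card_filter_mul_int_eq_ceil {f : ℕ → ℚ} {k i a : ℕ} (ha : 0 < a)
    (hmono : ∀ i j : ℕ, 1 ≤ i → i < j → j ≤ k + 1 → f i < f j)
    (hsurj : ∀ m < a, ∃ l : ℕ, 1 ≤ l ∧ l ≤ k ∧ f l = (m : ℚ) / a)
    (hf1 : f 1 = 0) (hfk1 : f (k + 1) = 1) (hi : 1 ≤ i) (hik : i ≤ k)
    [DecidablePred fun l => ∃ z : ℤ, (a : ℚ) * f l = z] :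
    #{l ∈ Icc 1 (i - 1) | ∃ z : ℤ, (a : ℚ) * f l = z} = ⌈(a : ℚ) * f i⌉₊ := by
  have ha' : (0 : ℚ) < a := by exact_mod_cast ha
  have hnonneg : ∀ l, 1 ≤ l → l ≤ k → 0 ≤ f l := by
    intro l hl hlk
    rcases hl.eq_or_lt with rfl | h
    · exact hf1.ge
    · exact hf1 ▸ (hmono 1 l le_rfl h (by lia)).le
  have hfloor : ∀ l, 1 ≤ l → l ≤ k → (∃ z : ℤ, (a : ℚ) * f l = z) →
      (⌊(a : ℚ) * f l⌋₊ : ℚ) = a * f l := by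
    rintro l hl hlk ⟨z, hz⟩
    have hz0 : 0 ≤ z := by
      have := mul_nonneg ha'.le (hnonneg l hl hlk)
      rw [hz] at this
      exact_mod_cast this
    lift z to ℕ using hz0
    rw [hz]
    simp
  rw [← card_range ⌈(a : ℚ) * f i⌉₊]
  refine card_bij (fun l _ => ⌊(a : ℚ) * f l⌋₊) ?_ ?_ ?_
  · intro l hl
    simp only [mem_filter, mem_Icc] at hl
    rw [mem_range, Nat.lt_ceil, hfloor l hl.1.1 (by lia) hl.2]
    exact mul_lt_mul_of_pos_left (hmono l i hl.1.1 (by lia) (by lia)) ha'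
  · intro l hl m hm h
    simp only [mem_filter, mem_Icc] at hl hm
    have hlm : f l = f m := by
      refine mul_left_cancel₀ ha'.ne' ?_
      rw [← hfloor l hl.1.1 (by lia) hl.2, ← hfloor m hm.1.1 (by lia) hm.2, h]
    rcases lt_trichotomy l m with h' | h' | h'
    · exact absurd hlm (hmono l m hl.1.1 h' (by lia)).ne
    · exact h'
    · exact absurd hlm (hmono m l hm.1.1 h' (by lia)).ne'
  · intro m hm
    rw [mem_range, Nat.lt_ceil] at hm
    have hfi : f i < 1 := hfk1 ▸ hmono i (k + 1) hi (by lia) le_rfl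
    have hma : m < a := by
      have : (m : ℚ) < a := hm.trans (mul_lt_of_lt_one_right ha' hfi)
      exact_mod_cast this
    obtain ⟨l, hl, hlk, hfl⟩ := hsurj m hma
    have hal : (a : ℚ) * f l = m := by rw [hfl]; field_simp
    have hli : l < i := by
      by_contra! hil
      have hle : f i ≤ f l := by
        rcases hil.eq_or_lt with rfl | h
        · exact le_rfl
        · exact (hmono i l hi h (by lia)).le
      have := mul_le_mul_of_nonneg_left hle ha'.le
      linarith
    refine ⟨l, ?_, ?_⟩
    · simp only [mem_filter, mem_Icc]
      exact ⟨⟨hl, by lia⟩, m, by simpa using hal⟩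
    · simp [hal]

theorem age_formula (n k : ℕ) (w : Fin (n + 1) → ℕ) (hw : ∀ j, 0 < w j)
    (f : ℕ → ℚ)
    (hmono : ∀ i j : ℕ, 1 ≤ i → i < j → j ≤ k + 1 → f i < f j)
    (hmem : ∀ i : ℕ, 1 ≤ i → i ≤ k → f i ∈ wpF n w)
    (hsurj : ∀ x ∈ wpF n w, ∃ i : ℕ, 1 ≤ i ∧ i ≤ k ∧ f i = x)
    (hf1 : f 1 = 0) (hfk1 : f (k + 1) = 1) :
    ∀ i : ℕ, 1 ≤ i → i ≤ k →
      ∑ j : Fin (n + 1), Int.fract (-((w j : ℚ) * f i)) =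
        (∑ l ∈ Finset.Icc 1 (i - 1), ((wpS n w (f l)).card : ℚ)) -
          (∑ j, (w j : ℚ)) * f i := by
  classical
  intro i hi hik
  have hfi : 0 ≤ f i := by
    rcases hi.eq_or_lt with rfl | h
    · exact hf1.ge
    · exact hf1 ▸ (hmono 1 i le_rfl h (by lia)).le
  have hcount : ∑ l ∈ Icc 1 (i - 1), (wpS n w (f l)).card = ∑ j, ⌈(w j : ℚ) * f i⌉₊ := by
    simp only [wpS, card_filter]
    rw [sum_comm]
    refine sum_congr rfl fun j _ => ?_
    rw [← card_filter_mul_int_eq_ceil (hw j) hmono (fun m hm => hsurj _ ?_) hf1 hfk1 hi hik,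
      card_filter]
    exact mem_image.2 ⟨⟨j, m⟩, by simpa using hm, rfl⟩
  rw [← Nat.cast_sum, hcount, Nat.cast_sum, sum_mul, ← sum_sub_distrib]
  refine sum_congr rfl fun j _ => ?_
  rw [Int.fract, Int.floor_neg, natCast_ceil_eq_intCast_ceil (by positivity)]
  push_cast
  ring
end

section
/- (Relation of Theorem 3.3) The matrix M satisfies w^w · M^σ = q · I, where I is the σ×σ identity matrix; i.e. the matrix of orbifold quantum multiplication by p satisfies the relation w^w p^σ = q of the abstract orbifold quantum cohomology ring QA = ℂ[p, q^{1/σ}]/(w^w p^σ − q). -/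
open Finset

theorem prod_range_add_of_periodic {R : Type*} [CommMonoid R] (g : ℕ → R) (s : ℕ)
    (hg : ∀ t, g (t + s) = g t) (a : ℕ) :
    ∏ t ∈ range s, g (a + t) = ∏ t ∈ range s, g t := by
  induction a with
  | zero => simp
  | succ a ih =>
    rw [← ih]
    cases s with
    | zero => simp
    | succ s =>
      rw [Finset.prod_range_succ, Finset.prod_range_succ']
      congr 1
      · exact Finset.prod_congr rfl fun t _ => by congr 1; omega
      · rw [← hg (a + 0)]
        congr 1
        omega

/-- Entries of the powers of a weighted cyclic shift matrix. -/
theorem weighted_cyclic_shift_pow {R : Type*} [CommSemiring R] {s : ℕ} (r : ℕ → R)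
    (M : Matrix (Fin s) (Fin s) R)
    (hM : ∀ β α : Fin s, M β α = if (β : ℕ) = ((α : ℕ) + 1) % s then r ((α : ℕ) + 1) else 0)
    (m : ℕ) (β α : Fin s) :
    (M ^ m) β α = if (β : ℕ) = ((α : ℕ) + m) % s
      then ∏ t ∈ range m, r (((α : ℕ) + t) % s + 1) else 0 := by
  have hs : 0 < s := α.pos
  induction m generalizing β with
  | zero =>
    simp [Matrix.one_apply, Nat.mod_eq_of_lt α.isLt, Fin.ext_iff]
  | succ m ih =>
    rw [pow_succ', Matrix.mul_apply,
      Finset.sum_eq_single (⟨((α : ℕ) + m) % s, Nat.mod_lt _ hs⟩ : Fin s)]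
    · rw [ih, hM, if_pos rfl, Finset.prod_range_succ]
      simp only [Nat.mod_add_mod, ← add_assoc, ite_mul, zero_mul]
      split_ifs
      · exact mul_comm _ _
      · rfl
    · intro γ _ hγ
      rw [ih, if_neg fun h => hγ (Fin.ext h), mul_zero]
    · intro h
      exact absurd (Finset.mem_univ _) h

/-- The `s`-th power of a weighted cyclic shift matrix of size `s` is scalar. -/
theorem weighted_cyclic_shift_pow_card {R : Type*} [CommSemiring R] {s : ℕ} (r : ℕ → R)
    (M : Matrix (Fin s) (Fin s) R)
    (hM : ∀ β α : Fin s, M β α = if (β : ℕ) = ((α : ℕ) + 1) % s then r ((α : ℕ) + 1) else 0) :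
    M ^ s = (∏ t ∈ range s, r (t + 1)) • (1 : Matrix (Fin s) (Fin s) R) := by
  ext β α
  rw [weighted_cyclic_shift_pow r M hM, Nat.add_mod_right, Nat.mod_eq_of_lt α.isLt,
    prod_range_add_of_periodic (fun t => r (t % s + 1)) s (fun t => by simp) α,
    Finset.prod_congr rfl fun t ht => by rw [Nat.mod_eq_of_lt (Finset.mem_range.1 ht)]]
  simp [Matrix.one_apply, Fin.ext_iff]

theorem mem_wpF {n : ℕ} {w : Fin (n + 1) → ℕ} {x : ℚ} :
    x ∈ wpF n w ↔ ∃ j, ∃ l < w j, (l : ℚ) / w j = x := by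
  simp [wpF, Sigma.exists]

theorem mem_wpS {n : ℕ} {w : Fin (n + 1) → ℕ} {x : ℚ} {j : Fin (n + 1)} :
    j ∈ wpS n w x ↔ ∃ z : ℤ, (w j : ℚ) * x = z := by
  simp [wpS]

theorem wpS_card_pos {n : ℕ} {w : Fin (n + 1) → ℕ} {x : ℚ} (hx : x ∈ wpF n w) :
    0 < (wpS n w x).card := by
  obtain ⟨j, l, hl, rfl⟩ := mem_wpF.1 hx
  have hj : (w j : ℚ) ≠ 0 := by exact_mod_cast (by omega : w j ≠ 0)
  exact Finset.card_pos.2 ⟨j, mem_wpS.2 ⟨l, by rw [mul_div_cancel₀ _ hj]; simp⟩⟩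

/-- Exactly `w j` elements `x` of `wpF n w` satisfy `w j * x ∈ ℤ`. -/
theorem card_filter_mem_wpS {n : ℕ} {w : Fin (n + 1) → ℕ} {j : Fin (n + 1)} (hj : 0 < w j) :
    ((wpF n w).filter fun x => j ∈ wpS n w x).card = w j := by
  have hj0 : (0 : ℚ) < w j := by exact_mod_cast hj
  have h : ((wpF n w).filter fun x => j ∈ wpS n w x) =
      (range (w j)).image fun l : ℕ => (l : ℚ) / w j := by
    ext x
    simp only [Finset.mem_filter, Finset.mem_image, Finset.mem_range]
    constructor
    · rintro ⟨hx, hxj⟩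
      obtain ⟨i, l, hl, rfl⟩ := mem_wpF.1 hx
      obtain ⟨z, hz⟩ := mem_wpS.1 hxj
      have hi0 : (0 : ℚ) < w i := by exact_mod_cast (by omega : 0 < w i)
      have hl' : (l : ℚ) < w i := by exact_mod_cast hl
      have hnn : (0 : ℚ) ≤ (l : ℚ) / w i := by positivity
      have hlt : (l : ℚ) / w i < 1 := (div_lt_one hi0).2 hl'
      have hz0 : (0 : ℤ) ≤ z := by
        have : (0 : ℚ) ≤ z := hz ▸ mul_nonneg hj0.le hnn
        exact_mod_cast this
      lift z to ℕ using hz0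
      have hzw : (z : ℚ) < w j := by
        have : (w j : ℚ) * ((l : ℚ) / w i) < w j := by nlinarith
        rw [hz] at this
        exact_mod_cast this
      refine ⟨z, by exact_mod_cast hzw, ?_⟩
      rw [div_eq_iff hj0.ne', mul_comm, hz]
      simp
    · rintro ⟨l, hl, rfl⟩
      exact ⟨mem_wpF.2 ⟨j, l, hl, rfl⟩,
        mem_wpS.2 ⟨l, by rw [mul_div_cancel₀ _ hj0.ne']; simp⟩⟩
  rw [h, Finset.card_image_of_injective, Finset.card_range]
  intro a b hab
  have := (div_left_inj' hj0.ne').1 hab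
  exact_mod_cast this

theorem sum_card_wpS {n : ℕ} {w : Fin (n + 1) → ℕ} (hw : ∀ j, 0 < w j) :
    ∑ x ∈ wpF n w, (wpS n w x).card = ∑ j, w j := by
  classical
  rw [← Finset.sum_congr rfl fun j _ => card_filter_mem_wpS (hw j)]
  simp only [Finset.card_filter]
  rw [Finset.sum_comm]
  exact Finset.sum_congr rfl fun x _ => by simp

theorem prod_prod_wpS {n : ℕ} {w : Fin (n + 1) → ℕ} (hw : ∀ j, 0 < w j) :
    ∏ x ∈ wpF n w, ∏ j ∈ wpS n w x, (w j : ℝ) = ∏ j, (w j : ℝ) ^ w j := by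
  classical
  have h : ∀ j ∈ (Finset.univ : Finset (Fin (n + 1))), (w j : ℝ) ^ w j =
      ∏ x ∈ wpF n w, if j ∈ wpS n w x then (w j : ℝ) else 1 := fun j _ => by
    rw [← Finset.prod_filter, Finset.prod_const, card_filter_mem_wpS (hw j)]
  rw [Finset.prod_congr rfl h, Finset.prod_comm]
  exact Finset.prod_congr rfl fun x _ => by simp

theorem matrix_relation (n k : ℕ) (w : Fin (n + 1) → ℕ) (hw : ∀ j, 0 < w j)
    (f : ℕ → ℚ)
    (hmono : ∀ i j : ℕ, 1 ≤ i → i < j → j ≤ k + 1 → f i < f j)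
    (hmem : ∀ i : ℕ, 1 ≤ i → i ≤ k → f i ∈ wpF n w)
    (hsurj : ∀ x ∈ wpF n w, ∃ i : ℕ, 1 ≤ i ∧ i ≤ k ∧ f i = x)
    (hf1 : f 1 = 0) (hfk1 : f (k + 1) = 1)
    (q : ℝ) (hq : 0 < q)
    (r : ℕ → ℝ)
    (hr_jump : ∀ α i : ℕ, 1 ≤ i → i ≤ k →
      α = ∑ l ∈ Finset.Icc 1 i, (wpS n w (f l)).card →
      r α = (1 / ∏ l ∈ wpS n w (f i), (w l : ℝ)) * q ^ ((f (i + 1) - f i : ℚ) : ℝ))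
    (hr_one : ∀ α : ℕ, 1 ≤ α → α ≤ ∑ j, w j →
      (∀ i : ℕ, 1 ≤ i → i ≤ k → α ≠ ∑ l ∈ Finset.Icc 1 i, (wpS n w (f l)).card) →
      r α = 1)
    (M : Matrix (Fin (∑ j, w j)) (Fin (∑ j, w j)) ℝ)
    (hM : ∀ β α : Fin (∑ j, w j),
      M β α = if (β : ℕ) = ((α : ℕ) + 1) % (∑ j, w j) then r ((α : ℕ) + 1) else 0) :
    (∏ j, (w j : ℝ) ^ w j) • M ^ (∑ j, w j) =
      q • (1 : Matrix (Fin (∑ j, w j)) (Fin (∑ j, w j)) ℝ) := by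
  have hinj : Set.InjOn f (Finset.Icc 1 k) := by
    intro a ha b hb hab
    simp only [Finset.coe_Icc, Set.mem_Icc] at ha hb
    rcases lt_trichotomy a b with h | h | h
    · exact absurd hab (hmono a b ha.1 h (by omega)).ne
    · exact h
    · exact absurd hab (hmono b a hb.1 h (by omega)).ne'
  have himage : (Finset.Icc 1 k).image f = wpF n w := by
    ext x
    simp only [Finset.mem_image, Finset.mem_Icc]
    constructor
    · rintro ⟨i, hi, rfl⟩
      exact hmem i hi.1 hi.2
    · intro hx
      obtain ⟨i, h1, h2, h3⟩ := hsurj x hx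
      exact ⟨i, ⟨h1, h2⟩, h3⟩
  have hk : k ≠ 0 := by
    rintro rfl
    rw [zero_add, hf1] at hfk1
    exact zero_ne_one hfk1
  set U : ℕ → ℕ := fun i => ∑ l ∈ Finset.Icc 1 i, (wpS n w (f l)).card with hU
  have hUk : U k = ∑ j, w j := by
    rw [← sum_card_wpS hw, ← himage, Finset.sum_image hinj]
  have hUmono : ∀ i j, i < j → j ≤ k → U i < U j := by
    intro i j hij hjk
    refine Finset.sum_lt_sum_of_subset (Finset.Icc_subset_Icc_right hij.le)
      (Finset.mem_Icc.2 ⟨by omega, le_refl j⟩) (by simp [hij])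
      (wpS_card_pos (hmem j (by omega) hjk)) fun _ _ _ => Nat.zero_le _
  have hUinj : Set.InjOn U (Finset.Icc 1 k) := by
    intro a ha b hb hab
    simp only [Finset.coe_Icc, Set.mem_Icc] at ha hb
    rcases lt_trichotomy a b with h | h | h
    · exact absurd hab (hUmono a b h hb.2).ne
    · exact h
    · exact absurd hab (hUmono b a h ha.2).ne'
  have hsub : (Finset.Icc 1 k).image U ⊆ Finset.Icc 1 (∑ j, w j) := by
    intro a ha
    obtain ⟨i, hi, rfl⟩ := Finset.mem_image.1 ha
    rw [Finset.mem_Icc] at hi ⊢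
    refine ⟨Nat.one_le_iff_ne_zero.2 (Nat.ne_zero_of_lt (hUmono 0 i (by omega) hi.2)), ?_⟩
    rw [← hUk]
    rcases hi.2.lt_or_eq with h | h
    · exact (hUmono i k h le_rfl).le
    · rw [h]
  have hprod : ∏ t ∈ range (∑ j, w j), r (t + 1) =
      ∏ i ∈ Finset.Icc 1 k,
        ((1 / ∏ l ∈ wpS n w (f i), (w l : ℝ)) * q ^ ((f (i + 1) - f i : ℚ) : ℝ)) := by
    rw [Finset.range_eq_Ico, Finset.prod_Ico_add' r, zero_add, Finset.Ico_add_one_right_eq_Icc,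
      ← Finset.prod_subset hsub, Finset.prod_image hUinj]
    · refine Finset.prod_congr rfl fun i hi => ?_
      rw [Finset.mem_Icc] at hi
      exact hr_jump (U i) i hi.1 hi.2 rfl
    · intro a ha hna
      rw [Finset.mem_Icc] at ha
      refine hr_one a ha.1 ha.2 fun i h1 h2 h => hna ?_
      exact Finset.mem_image.2 ⟨i, Finset.mem_Icc.2 ⟨h1, h2⟩, h.symm⟩
  have htel : ∑ i ∈ Finset.Icc 1 k, (f (i + 1) - f i) = 1 := by
    rw [← Finset.Ico_add_one_right_eq_Icc, Finset.sum_Ico_sub f (by omega), hfk1, hf1, sub_zero]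
  have hq1 : ∏ i ∈ Finset.Icc 1 k, q ^ ((f (i + 1) - f i : ℚ) : ℝ) = q := by
    rw [← Real.rpow_sum_of_pos hq, ← Rat.cast_sum, htel, Rat.cast_one, Real.rpow_one]
  have hm : ∏ i ∈ Finset.Icc 1 k, ∏ l ∈ wpS n w (f i), (w l : ℝ) = ∏ j, (w j : ℝ) ^ w j := by
    rw [← prod_prod_wpS hw, ← himage, Finset.prod_image hinj]
  have hne : ∏ j, (w j : ℝ) ^ w j ≠ 0 :=
    Finset.prod_ne_zero_iff.2 fun j _ => pow_ne_zero _ (by exact_mod_cast (hw j).ne')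
  rw [weighted_cyclic_shift_pow_card r M hM, smul_smul, hprod, Finset.prod_mul_distrib, hq1,
    Finset.prod_div_distrib, hm, Finset.prod_const_one, ← mul_assoc, mul_one_div_cancel hne,
    one_mul]
end
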